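/- Let F^i_μ, Π_μ : J¹ → ℝ be a smooth first-order constitutive relation and let ξ = Σ_i ξ^i(x)∂_{x^i} + Σ_μ ξ^μ(x,y)∂_{y^μ} be any smooth projectable vector field, with first-prolongation components ξ^μ_i = ∂_{x^i}ξ^μ + Σ_ν z^ν_i ∂_{y^ν}ξ^μ − Σ_j z^μ_j ∂_{x^i}ξ^j. Then every C² solution s of the balance system satisfies, for all x ∈ ℝⁿ, Σ_i ∂_{x^i}[ Σ_μ F^i_μ(j¹s(x)) Q^μ(x) ] = Σ_μ Π_μ(j¹s(x)) Q^μ(x) + Σ_{i,μ} F^i_μ(j¹s(x)) · ( ξ^μ_i(j¹s(x)) − Σ_k ∂_{x^i}∂_{x^k}s^μ(x) ξ^k(x) ), where Q^μ(x) = ξ^μ(x,s(x)) − Σ_j ∂_{x^j}s^μ(x) ξ^j(x). In particular, if ξ is C-admissible, i.e. the last sum vanishes identically along second jets of sections, and Π_μ ≡ 0 for all μ, then the Noether current Σ_μ F^i_μ(j¹s) Q^μ is divergence-free along every solution. -/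

import Mathlib

open scoped BigOperators

/-- The first jet space `J¹ = ℝⁿ × ℝᵐ × ℝ^{m×n}` with coordinates `(xⁱ, y^μ, z^μ_i)`. -/
abbrev Jet1 (n m : ℕ) : Type :=
  (Fin n → ℝ) × (Fin m → ℝ) × (Fin m → Fin n → ℝ)

/-- The first jet `j¹s(x) = (x, s(x), ∂s(x))` of a map `s : ℝⁿ → ℝᵐ`. -/
noncomputable def jet {n m : ℕ} (s : (Fin n → ℝ) → (Fin m → ℝ)) (x : Fin n → ℝ) :
    Jet1 n m :=
  (x, s x, fun μ i => fderiv ℝ s x (Pi.single i 1) μ)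

/-- The partial derivative `∂_{x^i} f(x)` of a scalar function on `ℝⁿ`. -/
noncomputable def pd {n : ℕ} (f : (Fin n → ℝ) → ℝ) (i : Fin n) (x : Fin n → ℝ) : ℝ :=
  fderiv ℝ f x (Pi.single i 1)

/-- The components `ξ^μ_i = ∂_{x^i}ξ^μ + Σ_ν z^ν_i ∂_{y^ν}ξ^μ − Σ_j z^μ_j ∂_{x^i}ξ^j`
of the first prolongation of a projectable vector field. -/
noncomputable def prolComp {n m : ℕ} (ξb : (Fin n → ℝ) → (Fin n → ℝ))
    (ξv : (Fin n → ℝ) × (Fin m → ℝ) → (Fin m → ℝ)) (μ : Fin m) (i : Fin n)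
    (w : Jet1 n m) : ℝ :=
  fderiv ℝ ξv (w.1, w.2.1) (Pi.single i 1, 0) μ
    + ∑ ν, w.2.2 ν i * fderiv ℝ ξv (w.1, w.2.1) (0, Pi.single ν 1) μ
    - ∑ j, w.2.2 μ j * fderiv ℝ ξb w.1 (Pi.single i 1) j

theorem contDiff_fderiv_apply_coord {n m : ℕ} {s : (Fin n → ℝ) → (Fin m → ℝ)}
    (hs : ContDiff ℝ 2 s) (v : Fin n → ℝ) (μ : Fin m) :
    ContDiff ℝ 1 (fun x => fderiv ℝ s x v μ) :=
  contDiff_pi.1 ((hs.fderiv_right (m := 1) (by norm_num)).clm_apply contDiff_const) μ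

theorem contDiff_jet {n m : ℕ} {s : (Fin n → ℝ) → (Fin m → ℝ)} (hs : ContDiff ℝ 2 s) :
    ContDiff ℝ 1 (jet s) :=
  contDiff_id.prodMk ((hs.of_le (by norm_num)).prodMk
    (contDiff_pi.2 fun μ => contDiff_pi.2 fun _ => contDiff_fderiv_apply_coord hs _ μ))

theorem ContinuousLinearMap.apply_prodMk_eq_add_sum {E : Type*} [NormedAddCommGroup E]
    [NormedSpace ℝ E] {n m : ℕ} (L : E × (Fin n → ℝ) →L[ℝ] (Fin m → ℝ)) (u : E)
    (v : Fin n → ℝ) (μ : Fin m) :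
    L (u, v) μ = L (u, 0) μ + ∑ ν, v ν * L (0, Pi.single ν 1) μ := by
  have hv : (u, v) = (u, 0) + ∑ ν, v ν • ((0 : E), (Pi.single ν 1 : Fin n → ℝ)) := by
    ext j
    · simp [Prod.fst_sum]
    · simp [Prod.snd_sum, Finset.sum_apply, Pi.single_apply]
  rw [hv, map_add, map_sum]
  simp only [map_smul, Pi.add_apply, Finset.sum_apply, Pi.smul_apply, smul_eq_mul]

/-- The characteristic `Q^μ = ξ^μ(x, s(x)) − Σ_j ∂_{x^j}s^μ(x) ξ^j(x)` of a projectable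
vector field along a section `s`. -/
noncomputable def characteristic {n m : ℕ} (ξb : (Fin n → ℝ) → (Fin n → ℝ))
    (ξv : (Fin n → ℝ) × (Fin m → ℝ) → (Fin m → ℝ)) (s : (Fin n → ℝ) → (Fin m → ℝ))
    (μ : Fin m) (x : Fin n → ℝ) : ℝ :=
  ξv (x, s x) μ - ∑ j, fderiv ℝ s x (Pi.single j 1) μ * ξb x j

section Characteristic

variable {n m : ℕ} {ξb : (Fin n → ℝ) → (Fin n → ℝ)}
  {ξv : (Fin n → ℝ) × (Fin m → ℝ) → (Fin m → ℝ)} {s : (Fin n → ℝ) → (Fin m → ℝ)}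

theorem hasFDerivAt_characteristic (hξb : Differentiable ℝ ξb) (hξv : Differentiable ℝ ξv)
    (hs : ContDiff ℝ 2 s) (μ : Fin m) (x : Fin n → ℝ) :
    HasFDerivAt (characteristic ξb ξv s μ)
      ((ContinuousLinearMap.proj μ).comp ((fderiv ℝ ξv (x, s x)).comp
          ((ContinuousLinearMap.id ℝ (Fin n → ℝ)).prod (fderiv ℝ s x)))
        - ∑ j, (fderiv ℝ s x (Pi.single j 1) μ •
              (ContinuousLinearMap.proj j).comp (fderiv ℝ ξb x)
            + ξb x j • fderiv ℝ (fun x' => fderiv ℝ s x' (Pi.single j 1) μ) x)) x := by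
  have hs' : HasFDerivAt s (fderiv ℝ s x) x :=
    (hs.differentiable (by norm_num) x).hasFDerivAt
  have hv : HasFDerivAt (fun x' => ξv (x', s x')) _ x :=
    (hξv (x, s x)).hasFDerivAt.comp x ((hasFDerivAt_id x).prodMk hs')
  refine (hasFDerivAt_pi'.1 hv μ).sub (HasFDerivAt.fun_sum fun j _ => ?_)
  exact ((contDiff_fderiv_apply_coord hs _ μ).differentiable (by norm_num) x).hasFDerivAt.mul
    (hasFDerivAt_pi'.1 (hξb x).hasFDerivAt j)

theorem pd_characteristic (hξb : Differentiable ℝ ξb) (hξv : Differentiable ℝ ξv)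
    (hs : ContDiff ℝ 2 s) (μ : Fin m) (i : Fin n) (x : Fin n → ℝ) :
    pd (characteristic ξb ξv s μ) i x = prolComp ξb ξv μ i (jet s x)
      - ∑ k, fderiv ℝ (fun x' => fderiv ℝ s x' (Pi.single k 1) μ) x (Pi.single i 1)
          * ξb x k := by
  rw [pd, (hasFDerivAt_characteristic hξb hξv hs μ x).fderiv]
  simp only [sub_apply, ContinuousLinearMap.comp_apply,
    ContinuousLinearMap.proj_apply, ContinuousLinearMap.prod_apply,
    ContinuousLinearMap.id_apply, sum_apply, add_apply,
    smul_apply, smul_eq_mul, Finset.sum_add_distrib, prolComp, jet]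
  rw [ContinuousLinearMap.apply_prodMk_eq_add_sum]
  simp only [mul_comm (ξb x _)]
  ring

end Characteristic

theorem pd_sum_mul {n : ℕ} {ι : Type*} [Fintype ι] {f g : ι → (Fin n → ℝ) → ℝ}
    {x : Fin n → ℝ} (hf : ∀ μ, DifferentiableAt ℝ (f μ) x)
    (hg : ∀ μ, DifferentiableAt ℝ (g μ) x) (i : Fin n) :
    pd (fun x' => ∑ μ, f μ x' * g μ x') i x
      = ∑ μ, pd (f μ) i x * g μ x + ∑ μ, f μ x * pd (g μ) i x := by
  have h := HasFDerivAt.fun_sum (u := Finset.univ) fun μ _ =>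
    (hf μ).hasFDerivAt.fun_mul (hg μ).hasFDerivAt
  rw [pd, h.fderiv, ← Finset.sum_add_distrib]
  simp only [sum_apply, add_apply, smul_apply, smul_eq_mul, pd]
  exact Finset.sum_congr rfl fun μ _ => by ring


/-- General Noether balance law for a first-order constitutive relation (lifted covering
constitutive relation) and an arbitrary projectable vector field `ξ`: along any solution
of the balance system, `Σ_i ∂_{x^i}[Σ_μ F^i_μ Q^μ] = Σ_μ Π_μ Q^μ + (defect term)`; if `ξ`
is `C`-admissible (the defect vanishes identically along second jets of sections) and the
sources vanish, the Noether current is divergence-free. -/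
theorem noether_balance_law_general {n m : ℕ}
    (F : Fin n → Fin m → Jet1 n m → ℝ) (Pr : Fin m → Jet1 n m → ℝ)
    (hF : ∀ i μ, ContDiff ℝ (⊤ : ℕ∞) (F i μ)) (hPr : ∀ μ, ContDiff ℝ (⊤ : ℕ∞) (Pr μ))
    (ξb : (Fin n → ℝ) → (Fin n → ℝ))
    (ξv : (Fin n → ℝ) × (Fin m → ℝ) → (Fin m → ℝ))
    (hξb : ContDiff ℝ (⊤ : ℕ∞) ξb) (hξv : ContDiff ℝ (⊤ : ℕ∞) ξv)
    (s : (Fin n → ℝ) → (Fin m → ℝ)) (hs : ContDiff ℝ 2 s)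
    -- `s` solves the balance system
    (hsol : ∀ (μ : Fin m) (x : Fin n → ℝ),
      ∑ i, pd (fun x' => F i μ (jet s x')) i x = Pr μ (jet s x)) :
    -- Noether balance law with defect term
    (∀ x : Fin n → ℝ,
      ∑ i, pd (fun x' => ∑ μ, F i μ (jet s x') *
          (ξv (x', s x') μ - ∑ j, fderiv ℝ s x' (Pi.single j 1) μ * ξb x' j)) i x
        = ∑ μ, Pr μ (jet s x) *
            (ξv (x, s x) μ - ∑ j, fderiv ℝ s x (Pi.single j 1) μ * ξb x j)
          + ∑ i, ∑ μ, F i μ (jet s x) *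
              (prolComp ξb ξv μ i (jet s x)
                - ∑ k, fderiv ℝ (fun x' => fderiv ℝ s x' (Pi.single k 1) μ) x
                    (Pi.single i 1) * ξb x k))
    ∧
    -- in particular: `C`-admissibility of `ξ` and vanishing sources give a conservation law
    ((∀ σ : (Fin n → ℝ) → (Fin m → ℝ), ContDiff ℝ 2 σ → ∀ x : Fin n → ℝ,
        ∑ i, ∑ μ, F i μ (jet σ x) *
          (prolComp ξb ξv μ i (jet σ x)
            - ∑ k, fderiv ℝ (fun x' => fderiv ℝ σ x' (Pi.single k 1) μ) x
                (Pi.single i 1) * ξb x k) = 0) →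
      (∀ (μ : Fin m) (w : Jet1 n m), Pr μ w = 0) →
      ∀ x : Fin n → ℝ,
        ∑ i, pd (fun x' => ∑ μ, F i μ (jet s x') *
            (ξv (x', s x') μ - ∑ j, fderiv ℝ s x' (Pi.single j 1) μ * ξb x' j)) i x = 0) := by
  have law : ∀ x : Fin n → ℝ,
      ∑ i, pd (fun x' => ∑ μ, F i μ (jet s x') * characteristic ξb ξv s μ x') i x
        = ∑ μ, Pr μ (jet s x) * characteristic ξb ξv s μ x
          + ∑ i, ∑ μ, F i μ (jet s x) *
              (prolComp ξb ξv μ i (jet s x)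
                - ∑ k, fderiv ℝ (fun x' => fderiv ℝ s x' (Pi.single k 1) μ) x
                    (Pi.single i 1) * ξb x k) := by
    intro x
    have hξb' : Differentiable ℝ ξb := hξb.differentiable (by simp)
    have hξv' : Differentiable ℝ ξv := hξv.differentiable (by simp)
    have hFjet : ∀ i μ, DifferentiableAt ℝ (fun x' => F i μ (jet s x')) x := fun i μ =>
      ((hF i μ).differentiable (by simp)).comp
        ((contDiff_jet hs).differentiable (by norm_num)) x
    have hQ : ∀ μ, DifferentiableAt ℝ (characteristic ξb ξv s μ) x := fun μ =>
      (hasFDerivAt_characteristic hξb' hξv' hs μ x).differentiableAt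
    simp only [pd_sum_mul (hFjet _) hQ, pd_characteristic hξb' hξv' hs,
      Finset.sum_add_distrib, ← hsol, Finset.sum_mul]
    rw [Finset.sum_comm]
  refine ⟨law, fun hadm hsrc x => (law x).trans ?_⟩
  rw [hadm s hs x]
  simp [hsrc]
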